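/- For every n ≥ 1, the number of fully commutative involutions of S_n (elements w with w² = e that are fully commutative) equals the binomial coefficient C(n, ⌊n/2⌋). -/

import Mathlib

/-- The simple transposition `s_i = (i, i+1)` in the symmetric group `S_n`,
for `i ∈ {1, …, n−1}` (here indexed by `Fin (n-1)`). -/
def simpleTransposition {n : ℕ} (i : Fin (n - 1)) : Equiv.Perm (Fin n) :=
  Equiv.swap ⟨i.1, by have := i.isLt; omega⟩ ⟨i.1 + 1, by have := i.isLt; omega⟩

/-- The permutation `s_{i_1} ⋯ s_{i_k}` determined by a word `(i_1, …, i_k)`. -/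
def wordProd {n : ℕ} (l : List (Fin (n - 1))) : Equiv.Perm (Fin n) :=
  (l.map simpleTransposition).prod

/-- `l` is a reduced word for `w`: it is a word for `w` of minimal length. -/
def IsReducedWord {n : ℕ} (l : List (Fin (n - 1))) (w : Equiv.Perm (Fin n)) : Prop :=
  wordProd l = w ∧ ∀ l' : List (Fin (n - 1)), wordProd l' = w → l.length ≤ l'.length

/-- One commutation move: swap two adjacent letters `a`, `b` with `|a − b| ≥ 2`. -/
def CommStep {n : ℕ} (l l' : List (Fin (n - 1))) : Prop :=
  ∃ (u v : List (Fin (n - 1))) (a b : Fin (n - 1)),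
    (a.1 + 2 ≤ b.1 ∨ b.1 + 2 ≤ a.1) ∧
    l = u ++ a :: b :: v ∧ l' = u ++ b :: a :: v

/-- Two words are commutation-equivalent if one is obtained from the other by finitely
many commutation moves. -/
def CommEquiv {n : ℕ} (l l' : List (Fin (n - 1))) : Prop :=
  Relation.ReflTransGen CommStep l l'

/-- `w ∈ S_n` is fully commutative if any two reduced words for `w` are
commutation-equivalent. -/
def FullyCommutative {n : ℕ} (w : Equiv.Perm (Fin n)) : Prop :=
  ∀ l l' : List (Fin (n - 1)), IsReducedWord l w → IsReducedWord l' w → CommEquiv l l'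


open Finset

section Inversions

variable {n : ℕ}

/-- The first of the two positions exchanged by `simpleTransposition p`. -/
def lowerPos (p : Fin (n - 1)) : Fin n := ⟨p.1, by have := p.isLt; omega⟩

/-- The second of the two positions exchanged by `simpleTransposition p`. -/
def upperPos (p : Fin (n - 1)) : Fin n := ⟨p.1 + 1, by have := p.isLt; omega⟩

lemma simpleTransposition_eq (p : Fin (n - 1)) :
    simpleTransposition p = Equiv.swap (lowerPos p) (upperPos p) := rfl

lemma lowerPos_lt_upperPos (p : Fin (n - 1)) : lowerPos p < upperPos p := by
  simp [lowerPos, upperPos, Fin.lt_def]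

@[simp] lemma simpleTransposition_lowerPos (p : Fin (n - 1)) :
    simpleTransposition p (lowerPos p) = upperPos p := Equiv.swap_apply_left _ _

@[simp] lemma simpleTransposition_upperPos (p : Fin (n - 1)) :
    simpleTransposition p (upperPos p) = lowerPos p := Equiv.swap_apply_right _ _

lemma simpleTransposition_of_ne {p : Fin (n - 1)} {a : Fin n} (h₁ : a ≠ lowerPos p)
    (h₂ : a ≠ upperPos p) : simpleTransposition p a = a :=
  Equiv.swap_apply_of_ne_of_ne h₁ h₂

@[simp] lemma simpleTransposition_mul_self (p : Fin (n - 1)) :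
    simpleTransposition p * simpleTransposition p = 1 := Equiv.swap_mul_self _ _

@[simp] lemma simpleTransposition_apply_apply (p : Fin (n - 1)) (a : Fin n) :
    simpleTransposition p (simpleTransposition p a) = a := by
  rw [← Equiv.Perm.mul_apply, simpleTransposition_mul_self, Equiv.Perm.one_apply]

@[simp] lemma mul_simpleTransposition_cancel (w : Equiv.Perm (Fin n)) (p : Fin (n - 1)) :
    w * simpleTransposition p * simpleTransposition p = w := by
  rw [mul_assoc, simpleTransposition_mul_self, mul_one]

/-- A simple transposition preserves the order of every pair except the one it exchanges. -/
lemma simpleTransposition_lt {p : Fin (n - 1)} {a b : Fin n} (hab : a < b)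
    (hne : ¬(a = lowerPos p ∧ b = upperPos p)) :
    simpleTransposition p a < simpleTransposition p b := by
  rw [simpleTransposition_eq, Equiv.swap_apply_def, Equiv.swap_apply_def]
  simp only [lowerPos, upperPos, Fin.ext_iff, Fin.lt_def] at *
  split_ifs <;> (try dsimp only) <;> omega

/-- The inversions of `w`: pairs of positions whose values are out of order. -/
def inversions (w : Equiv.Perm (Fin n)) : Finset (Fin n × Fin n) :=
  {x | x.1 < x.2 ∧ w x.2 < w x.1}

lemma mem_inversions {w : Equiv.Perm (Fin n)} {x : Fin n × Fin n} :
    x ∈ inversions w ↔ x.1 < x.2 ∧ w x.2 < w x.1 := by simp [inversions]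

/-- `p` is a descent of `w`. -/
def IsDescent (w : Equiv.Perm (Fin n)) (p : Fin (n - 1)) : Prop :=
  w (upperPos p) < w (lowerPos p)

lemma isDescent_mul_simpleTransposition {w : Equiv.Perm (Fin n)} {p : Fin (n - 1)} :
    IsDescent (w * simpleTransposition p) p ↔ ¬ IsDescent w p := by
  have : w (lowerPos p) ≠ w (upperPos p) := w.injective.ne (lowerPos_lt_upperPos p).ne
  simp only [IsDescent, Equiv.Perm.mul_apply, simpleTransposition_lowerPos,
    simpleTransposition_upperPos, not_lt]
  exact ⟨le_of_lt, fun h => lt_of_le_of_ne h this⟩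

lemma card_inversions_of_isDescent {w : Equiv.Perm (Fin n)} {p : Fin (n - 1)}
    (h : IsDescent w p) :
    #(inversions w) = #(inversions (w * simpleTransposition p)) + 1 := by
  have hmem : (lowerPos p, upperPos p) ∈ inversions w :=
    mem_inversions.2 ⟨lowerPos_lt_upperPos p, h⟩
  rw [← card_erase_add_one hmem]
  congr 1
  refine card_bij' (fun x _ => (simpleTransposition p x.1, simpleTransposition p x.2))
    (fun x _ => (simpleTransposition p x.1, simpleTransposition p x.2)) ?_ ?_ ?_ ?_
  · rintro ⟨a, b⟩ hx
    simp only [mem_erase, mem_inversions, ne_eq, Prod.mk.injEq] at hx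
    simp only [mem_inversions, Equiv.Perm.mul_apply, simpleTransposition_apply_apply]
    exact ⟨simpleTransposition_lt hx.2.1 hx.1, hx.2.2⟩
  · rintro ⟨a, b⟩ hx
    simp only [mem_inversions, Equiv.Perm.mul_apply] at hx
    have hne : ¬(a = lowerPos p ∧ b = upperPos p) := by
      rintro ⟨rfl, rfl⟩
      simp only [simpleTransposition_lowerPos, simpleTransposition_upperPos] at hx
      exact lt_asymm h hx.2
    have hlt := simpleTransposition_lt hx.1 hne
    simp only [mem_erase, mem_inversions, ne_eq, Prod.mk.injEq]
    refine ⟨?_, hlt, hx.2⟩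
    rintro ⟨ha, hb⟩
    have ha' := congrArg (simpleTransposition p) ha
    have hb' := congrArg (simpleTransposition p) hb
    simp only [simpleTransposition_apply_apply, simpleTransposition_lowerPos,
      simpleTransposition_upperPos] at ha' hb'
    subst ha' hb'
    exact lt_asymm hx.1 (lowerPos_lt_upperPos p)
  · simp
  · simp

lemma card_inversions_mul_simpleTransposition_le (w : Equiv.Perm (Fin n)) (p : Fin (n - 1)) :
    #(inversions (w * simpleTransposition p)) ≤ #(inversions w) + 1 := by
  by_cases h : IsDescent w p
  · have := card_inversions_of_isDescent h
    omega
  · have := card_inversions_of_isDescent (isDescent_mul_simpleTransposition.2 h)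
    rw [mul_simpleTransposition_cancel] at this
    omega

lemma wordProd_concat (l : List (Fin (n - 1))) (p : Fin (n - 1)) :
    wordProd (l ++ [p]) = wordProd l * simpleTransposition p := by
  simp [wordProd]

lemma card_inversions_one : #(inversions (1 : Equiv.Perm (Fin n))) = 0 := by
  rw [card_eq_zero, eq_empty_iff_forall_notMem]
  intro x hx
  exact lt_asymm (mem_inversions.1 hx).1 (mem_inversions.1 hx).2

lemma card_inversions_wordProd_le (l : List (Fin (n - 1))) :
    #(inversions (wordProd l)) ≤ l.length := by
  induction l using List.reverseRecOn with
  | nil => simp [wordProd, card_inversions_one]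
  | append_singleton l p ih =>
    rw [wordProd_concat, List.length_append, List.length_singleton]
    exact (card_inversions_mul_simpleTransposition_le _ _).trans (by omega)

lemma exists_isDescent {w : Equiv.Perm (Fin n)} (hw : w ≠ 1) : ∃ p, IsDescent w p := by
  by_contra! h
  apply hw
  have hmono : StrictMono w := by
    rcases n with _ | n
    · exact fun a => a.elim0
    · refine Fin.strictMono_iff_lt_succ.2 fun i => ?_
      have hne : w i.castSucc ≠ w i.succ := w.injective.ne (Fin.castSucc_lt_succ).ne
      exact lt_of_le_of_ne (not_lt.1 (h i)) hne
  ext i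
  have := Subsingleton.elim (hmono.orderIsoOfSurjective w w.surjective) (OrderIso.refl _)
  exact congrArg Fin.val (DFunLike.congr_fun this i)

lemma exists_word_length_eq (w : Equiv.Perm (Fin n)) :
    ∃ l, wordProd l = w ∧ l.length = #(inversions w) := by
  induction hk : #(inversions w) generalizing w with
  | zero =>
    by_cases hw : w = 1
    · exact ⟨[], by simp [wordProd, hw], rfl⟩
    · obtain ⟨p, hp⟩ := exists_isDescent hw
      have := card_inversions_of_isDescent hp
      omega
  | succ k ih =>
    have hw : w ≠ 1 := by
      rintro rfl
      simp [card_inversions_one] at hk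
    obtain ⟨p, hp⟩ := exists_isDescent hw
    have := card_inversions_of_isDescent hp
    obtain ⟨l, hl, hlen⟩ := ih (w * simpleTransposition p) (by omega)
    exact ⟨l ++ [p], by rw [wordProd_concat, hl, mul_simpleTransposition_cancel], by simp [hlen]⟩

lemma isReducedWord_iff {l : List (Fin (n - 1))} {w : Equiv.Perm (Fin n)} :
    IsReducedWord l w ↔ wordProd l = w ∧ l.length = #(inversions w) := by
  constructor
  · rintro ⟨rfl, h⟩
    obtain ⟨m, hm, hlen⟩ := exists_word_length_eq (wordProd l)
    exact ⟨rfl, le_antisymm (hlen ▸ h m hm) (card_inversions_wordProd_le l)⟩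
  · rintro ⟨rfl, h⟩
    exact ⟨rfl, fun m hm => h.trans_le (hm ▸ card_inversions_wordProd_le m)⟩

lemma exists_isReducedWord (w : Equiv.Perm (Fin n)) : ∃ l, IsReducedWord l w :=
  (exists_word_length_eq w).imp fun _ => isReducedWord_iff.2

lemma IsReducedWord.concat {l : List (Fin (n - 1))} {w : Equiv.Perm (Fin n)} {p : Fin (n - 1)}
    (hl : IsReducedWord l (w * simpleTransposition p)) (hp : IsDescent w p) :
    IsReducedWord (l ++ [p]) w := by
  rw [isReducedWord_iff] at hl ⊢
  rw [wordProd_concat, hl.1, mul_simpleTransposition_cancel, card_inversions_of_isDescent hp]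
  simp [hl.2]

lemma IsReducedWord.of_concat {l : List (Fin (n - 1))} {w : Equiv.Perm (Fin n)}
    {p : Fin (n - 1)} (hl : IsReducedWord (l ++ [p]) w) :
    IsDescent w p ∧ IsReducedWord l (w * simpleTransposition p) := by
  rw [isReducedWord_iff, wordProd_concat, List.length_append, List.length_singleton] at hl
  have hprod : wordProd l = w * simpleTransposition p := by
    rw [← hl.1, mul_simpleTransposition_cancel]
  have hle := card_inversions_wordProd_le l
  rw [hprod] at hle
  by_cases hp : IsDescent w p
  · have := card_inversions_of_isDescent hp
    exact ⟨hp, isReducedWord_iff.2 ⟨hprod, by omega⟩⟩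
  · have := card_inversions_of_isDescent (isDescent_mul_simpleTransposition.2 hp)
    rw [mul_simpleTransposition_cancel] at this
    omega

end Inversions

section Avoiding

variable {n : ℕ}

/-- `w` has no decreasing subsequence of length three. -/
def Avoids321 (w : Equiv.Perm (Fin n)) : Prop :=
  ∀ i j k, i < j → j < k → w k < w j → ¬ w j < w i

lemma Avoids321.mul_simpleTransposition {w : Equiv.Perm (Fin n)} (hw : Avoids321 w)
    {p : Fin (n - 1)} (hp : IsDescent w p) : Avoids321 (w * simpleTransposition p) := by
  have key : ∀ a b : Fin n, a < b →
      (w * simpleTransposition p) b < (w * simpleTransposition p) a →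
      simpleTransposition p a < simpleTransposition p b := by
    intro a b hab h
    refine simpleTransposition_lt hab ?_
    rintro ⟨rfl, rfl⟩
    exact isDescent_mul_simpleTransposition.1 h hp
  intro i j k hij hjk hkj hji
  exact hw _ _ _ (key i j hij hji) (key j k hjk hkj) hkj hji

lemma CommEquiv.concat {l l' : List (Fin (n - 1))} (h : CommEquiv l l') (p : Fin (n - 1)) :
    CommEquiv (l ++ [p]) (l' ++ [p]) := by
  refine Relation.ReflTransGen.lift (r := CommStep) (· ++ [p]) ?_ _ _ h
  rintro _ _ ⟨u, v, a, b, hab, rfl, rfl⟩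
  exact ⟨u, v ++ [p], a, b, hab, by simp, by simp⟩

lemma CommEquiv.perm {l l' : List (Fin (n - 1))} (h : CommEquiv l l') : l.Perm l' := by
  induction h with
  | refl => exact .refl _
  | tail _ hs ih =>
    obtain ⟨u, v, a, b, -, rfl, rfl⟩ := hs
    exact ih.trans ((List.Perm.swap b a v).append_left u)

lemma commEquiv_concat_concat (l : List (Fin (n - 1))) {p q : Fin (n - 1)}
    (h : p.1 + 2 ≤ q.1 ∨ q.1 + 2 ≤ p.1) : CommEquiv (l ++ [p] ++ [q]) (l ++ [q] ++ [p]) :=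
  .single ⟨l, [], p, q, h, by simp, by simp⟩

lemma IsDescent.mul_of_far {w : Equiv.Perm (Fin n)} {p q : Fin (n - 1)}
    (hq : IsDescent w q) (h : p.1 + 2 ≤ q.1 ∨ q.1 + 2 ≤ p.1) :
    IsDescent (w * simpleTransposition p) q := by
  have h₁ : simpleTransposition p (lowerPos q) = lowerPos q := by
    apply simpleTransposition_of_ne <;> simp only [lowerPos, upperPos, ne_eq, Fin.ext_iff] <;> omega
  have h₂ : simpleTransposition p (upperPos q) = upperPos q := by
    apply simpleTransposition_of_ne <;> simp only [lowerPos, upperPos, ne_eq, Fin.ext_iff] <;> omega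
  simpa [IsDescent, h₁, h₂] using hq

lemma simpleTransposition_comm {p q : Fin (n - 1)} (h : p.1 + 2 ≤ q.1 ∨ q.1 + 2 ≤ p.1) :
    simpleTransposition p * simpleTransposition q =
      simpleTransposition q * simpleTransposition p := by
  refine Equiv.Perm.Disjoint.commute fun x => ?_
  by_cases hx : x = lowerPos p ∨ x = upperPos p
  · right
    rcases hx with rfl | rfl <;> apply simpleTransposition_of_ne <;>
      simp only [lowerPos, upperPos, ne_eq, Fin.ext_iff] <;> omega
  · left
    push Not at hx
    exact simpleTransposition_of_ne hx.1 hx.2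

lemma Avoids321.far_of_isDescent {w : Equiv.Perm (Fin n)} (hw : Avoids321 w)
    {p q : Fin (n - 1)} (hp : IsDescent w p) (hq : IsDescent w q) (hpq : p ≠ q) :
    p.1 + 2 ≤ q.1 ∨ q.1 + 2 ≤ p.1 := by
  have key : ∀ p q : Fin (n - 1), IsDescent w p → IsDescent w q → q.1 ≠ p.1 + 1 := by
    intro p q hp hq h
    have heq : lowerPos q = upperPos p := Fin.ext h
    unfold IsDescent at hp hq
    rw [heq] at hq
    exact hw _ _ _ (lowerPos_lt_upperPos p) (heq ▸ lowerPos_lt_upperPos q) hq hp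
  have h₁ := key p q hp hq
  have h₂ := key q p hq hp
  have h₃ : p.1 ≠ q.1 := fun h => hpq (Fin.ext h)
  omega

lemma Avoids321.fullyCommutative {w : Equiv.Perm (Fin n)} (hw : Avoids321 w) :
    FullyCommutative w := by
  intro l l' hl hl'
  induction hk : l.length generalizing w l l' with
  | zero =>
    have hlen : l.length = l'.length :=
      (isReducedWord_iff.1 hl).2.trans (isReducedWord_iff.1 hl').2.symm
    obtain rfl := List.length_eq_zero_iff.1 hk
    obtain rfl := List.length_eq_zero_iff.1 hlen.symm
    exact .refl
  | succ k ih =>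
    have hlen : l.length = l'.length :=
      (isReducedWord_iff.1 hl).2.trans (isReducedWord_iff.1 hl').2.symm
    obtain ⟨m, p, rfl⟩ := List.eq_nil_or_concat' l |>.resolve_left (by rintro rfl; simp at hk)
    obtain ⟨m', q, rfl⟩ := List.eq_nil_or_concat' l' |>.resolve_left
      (by rintro rfl; simp at hlen)
    simp only [List.length_append, List.length_singleton] at hk hlen
    obtain ⟨hp, hm⟩ := hl.of_concat
    obtain ⟨hq, hm'⟩ := hl'.of_concat
    by_cases hpq : p = q
    · subst hpq
      exact (ih (hw.mul_simpleTransposition hp) m m' hm hm' (by omega)).concat p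
    · have hfar := hw.far_of_isDescent hp hq hpq
      obtain ⟨r, hr⟩ := exists_isReducedWord (w * simpleTransposition p * simpleTransposition q)
      have hr₁ := hr.concat (hq.mul_of_far hfar)
      rw [mul_assoc, simpleTransposition_comm hfar, ← mul_assoc] at hr
      have hr₂ := hr.concat (hp.mul_of_far hfar.symm)
      have e₁ := (ih (hw.mul_simpleTransposition hp) _ _ hm hr₁ (by omega)).concat p
      have e₂ := (ih (hw.mul_simpleTransposition hq) _ _ hr₂ hm' (by
        have := (isReducedWord_iff.1 hr₂).2
        have := (isReducedWord_iff.1 hm').2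
        omega)).concat q
      exact (e₁.trans (commEquiv_concat_concat r hfar.symm)).trans e₂

lemma simpleTransposition_braid {p q : Fin (n - 1)} (h : q.1 = p.1 + 1) :
    simpleTransposition p * simpleTransposition q * simpleTransposition p =
      simpleTransposition q * simpleTransposition p * simpleTransposition q := by
  have heq : lowerPos q = upperPos p := Fin.ext h
  have hlt := lowerPos_lt_upperPos p
  have hlt' := lowerPos_lt_upperPos q
  rw [heq] at hlt'
  simp only [simpleTransposition_eq, heq]
  have h₁ := Equiv.swap_mul_swap_mul_swap hlt'.ne' (hlt.trans hlt').ne'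
  have h₂ := Equiv.swap_mul_swap_mul_swap hlt.ne (hlt.trans hlt').ne
  rw [h₂, Equiv.swap_comm _ (lowerPos p), ← h₁, Equiv.swap_comm (lowerPos p),
    Equiv.swap_comm (upperPos p) (upperPos q)]

/-- A permutation with a `321` pattern has a reduced word with a braid factor. -/
lemma exists_braid_of_pattern (d : ℕ) (w : Equiv.Perm (Fin n)) (i j k : Fin n) (hd : k.1 = i.1 + d)
    (hij : i < j) (hjk : j < k) (hkj : w k < w j) (hji : w j < w i) :
    ∃ (u v : List (Fin (n - 1))) (p q : Fin (n - 1)), q.1 = p.1 + 1 ∧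
      IsReducedWord (u ++ [p, q, p] ++ v) w := by
  induction d generalizing w i j k with
  | zero => simp only [Fin.lt_def] at hij hjk; omega
  | succ d ih =>
    have hi := i.isLt
    have hj := j.isLt
    have hk := k.isLt
    have hij' := hij
    have hjk' := hjk
    rw [Fin.lt_def] at hij' hjk'
    by_cases hj1 : i.1 + 1 < j.1
    · let p : Fin (n - 1) := ⟨i.1, by omega⟩
      have hlo : lowerPos p = i := rfl
      have hup : upperPos p < j := hj1
      have hkp : k.1 = (upperPos p).1 + d := by simp only [upperPos, p]; omega
      by_cases hv : w j < w (upperPos p)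
      · exact ih w _ j k hkp hup hjk hkj hv
      · have hne : w (upperPos p) ≠ w j := w.injective.ne hup.ne
        have hdesc : IsDescent w p := (lt_of_le_of_ne (not_lt.1 hv) hne).trans hji
        have fixed : ∀ x, upperPos p < x → simpleTransposition p x = x := fun x hx =>
          simpleTransposition_of_ne ((lowerPos_lt_upperPos p).trans hx).ne' hx.ne'
        obtain ⟨u, v, a, b, hab, hred⟩ := ih (w * simpleTransposition p) (upperPos p) j k hkp hup hjk
          (by simpa [fixed j hup, fixed k (hup.trans hjk)] using hkj)
          (by simpa [fixed j hup, hlo] using hji)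
        exact ⟨u, v ++ [p], a, b, hab, by simpa using hred.concat hdesc⟩
    · by_cases hk1 : j.1 + 1 < k.1
      · let p : Fin (n - 1) := ⟨k.1 - 1, by omega⟩
        have hup : upperPos p = k := Fin.ext (by simp only [upperPos, p]; omega)
        have hlo : j < lowerPos p := by simp only [lowerPos, p, Fin.lt_def]; omega
        have hkp : (lowerPos p).1 = i.1 + d := by simp only [lowerPos, p]; omega
        by_cases hv : w (lowerPos p) < w j
        · exact ih w i j _ hkp hij hlo hv hji
        · have hne : w j ≠ w (lowerPos p) := w.injective.ne hlo.ne
          have hdesc : IsDescent w p := by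
            unfold IsDescent
            rw [hup]
            exact hkj.trans (lt_of_le_of_ne (not_lt.1 hv) hne)
          have fixed : ∀ x, x < lowerPos p → simpleTransposition p x = x := fun x hx =>
            simpleTransposition_of_ne hx.ne (hx.trans (lowerPos_lt_upperPos p)).ne
          obtain ⟨u, v, a, b, hab, hred⟩ := ih (w * simpleTransposition p) i j (lowerPos p) hkp hij
            hlo (by simpa [fixed j hlo, hup] using hkj)
            (by simpa [fixed j hlo, fixed i (hij.trans hlo)] using hji)
          exact ⟨u, v ++ [p], a, b, hab, by simpa using hred.concat hdesc⟩
      · let p : Fin (n - 1) := ⟨i.1, by omega⟩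
        let q : Fin (n - 1) := ⟨i.1 + 1, by omega⟩
        have hpi : lowerPos p = i := rfl
        have hpj : upperPos p = j := Fin.ext (by simp only [upperPos, p]; omega)
        have hqj : lowerPos q = j := Fin.ext (by simp only [lowerPos, q]; omega)
        have hqk : upperPos q = k := Fin.ext (by simp only [upperPos, q]; omega)
        have spi : simpleTransposition p i = j := by rw [← hpi, simpleTransposition_lowerPos, hpj]
        have spj : simpleTransposition p j = i := by rw [← hpj, simpleTransposition_upperPos, hpi]
        have sqj : simpleTransposition q j = k := by rw [← hqj, simpleTransposition_lowerPos, hqk]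
        have spk : simpleTransposition p k = k :=
          simpleTransposition_of_ne (hpi ▸ (hij.trans hjk).ne') (hpj ▸ hjk.ne')
        have sqi : simpleTransposition q i = i :=
          simpleTransposition_of_ne (hqj ▸ hij.ne) (hqk ▸ (hij.trans hjk).ne)
        have d₁ : IsDescent w p := by rw [IsDescent, hpi, hpj]; exact hji
        have d₂ : IsDescent (w * simpleTransposition p) q := by
          simpa [IsDescent, hqj, hqk, spj, spk] using hkj.trans hji
        have d₃ : IsDescent (w * simpleTransposition p * simpleTransposition q) p := by
          simpa [IsDescent, hpi, hpj, sqj, sqi, spk, spi] using hkj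
        obtain ⟨u, hu⟩ := exists_isReducedWord
          (w * simpleTransposition p * simpleTransposition q * simpleTransposition p)
        exact ⟨u, [], p, q, rfl, by simpa using ((hu.concat d₃).concat d₂).concat d₁⟩

lemma FullyCommutative.avoids321 {w : Equiv.Perm (Fin n)} (hw : FullyCommutative w) :
    Avoids321 w := by
  intro i j k hij hjk hkj hji
  obtain ⟨u, v, p, q, hpq, hred⟩ := exists_braid_of_pattern (k.1 - i.1) w i j k
    (by simp only [Fin.lt_def] at hij hjk; omega) hij hjk hkj hji
  have hred' : IsReducedWord (u ++ [q, p, q] ++ v) w := by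
    rw [isReducedWord_iff] at hred ⊢
    refine ⟨?_, by simpa using hred.2⟩
    have hb := simpleTransposition_braid hpq
    rw [← hred.1]
    simp only [mul_assoc] at hb
    simp [wordProd, ← mul_assoc]
    simp [mul_assoc, hb]
  have hcount := (hw _ _ hred hred').perm.count_eq p
  have hne : q ≠ p := fun h => by rw [h] at hpq; omega
  simp [List.count_append, hne] at hcount

end Avoiding

section Involutions

variable {n : ℕ}

/-- The positions at which `w` takes a smaller value. -/
def deficiencies (w : Equiv.Perm (Fin n)) : Finset (Fin n) := {i | w i < i}

lemma mem_deficiencies {w : Equiv.Perm (Fin n)} {i : Fin n} : i ∈ deficiencies w ↔ w i < i := by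
  simp [deficiencies]

/-- Every initial segment has at least as many elements outside `D` as inside `D`. -/
def IsBallot (D : Finset (Fin n)) : Prop :=
  ∀ i, #{j | j ≤ i ∧ j ∈ D} ≤ #{j | j ≤ i ∧ j ∉ D}

lemma apply_apply_of_mul_self {w : Equiv.Perm (Fin n)} (hw : w * w = 1) (i : Fin n) :
    w (w i) = i := by
  rw [← Equiv.Perm.mul_apply, hw, Equiv.Perm.one_apply]

lemma isBallot_deficiencies {w : Equiv.Perm (Fin n)} (hw : w * w = 1) :
    IsBallot (deficiencies w) := by
  intro i
  refine card_le_card_of_injOn w ?_ w.injective.injOn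
  intro j hj
  simp only [mem_coe, mem_filter, mem_univ, true_and, mem_deficiencies] at hj ⊢
  rw [apply_apply_of_mul_self hw]
  exact ⟨hj.2.le.trans hj.1, hj.2.not_gt⟩

/-- For involutions, avoiding `321` means that no arc `a < w a` covers a fixed point or
another arc. -/
lemma avoids321_iff_of_mul_self {w : Equiv.Perm (Fin n)} (hw : w * w = 1) :
    Avoids321 w ↔ ∀ a c, a < c → c ≤ w c → w a < w c := by
  have hww := apply_apply_of_mul_self hw
  constructor
  · intro h a c hac hc
    by_contra hlt
    have hlt' : w c < w a := lt_of_le_of_ne (not_lt.1 hlt) (w.injective.ne hac.ne')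
    refine h a c (w a) hac (hc.trans_lt hlt') ?_ hlt'
    rw [hww]
    exact hac.trans_le hc
  · intro h i j k hij hjk hkj hji
    by_cases hj : j ≤ w j
    · exact lt_asymm hji (h i j hij hj)
    · have := h (w k) (w j) hkj (by rw [hww]; exact (not_le.1 hj).le)
      rw [hww, hww] at this
      exact lt_asymm this hjk

lemma eq_of_deficiencies_eq {w w' : Equiv.Perm (Fin n)} (hw : w * w = 1) (hw' : w' * w' = 1)
    (ha : Avoids321 w) (ha' : Avoids321 w') (h : deficiencies w = deficiencies w') : w = w' := by
  have key : ∀ {v v' : Equiv.Perm (Fin n)}, v * v = 1 → v' * v' = 1 → Avoids321 v →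
      deficiencies v = deficiencies v' → ∀ i, i ∉ deficiencies v →
      (∀ k, i < k → k ∉ deficiencies v → v k = v' k) → ¬ v i < v' i := by
    intro v v' hv hv' hva hD i hi ih hlt
    rw [avoids321_iff_of_mul_self hv] at hva
    rw [mem_deficiencies, not_lt] at hi
    have hj : v (v' i) < v' i := by
      rw [← mem_deficiencies, hD, mem_deficiencies, apply_apply_of_mul_self hv']
      exact hi.trans_lt hlt
    rcases lt_trichotomy (v (v' i)) i with h | h | h
    · have := hva _ _ h hi
      rw [apply_apply_of_mul_self hv] at this
      exact lt_asymm this hlt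
    · rw [← h, apply_apply_of_mul_self hv, h] at hlt
      exact hlt.false
    · have := ih _ h (by
        rw [mem_deficiencies, apply_apply_of_mul_self hv]
        exact hj.not_gt)
      rw [apply_apply_of_mul_self hv] at this
      exact h.ne (v'.injective this)
  have main : ∀ i, i ∉ deficiencies w → w i = w' i := by
    intro i
    induction i using WellFoundedGT.induction with
    | ind i ih =>
      intro hi
      refine le_antisymm (not_lt.1 (key hw' hw ha' h.symm i (h ▸ hi) ?_))
        (not_lt.1 (key hw hw' ha h i hi ih))
      intro k hk hkD
      exact (ih k hk (h ▸ hkD)).symm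
  refine Equiv.ext fun i => ?_
  by_cases hi : i ∈ deficiencies w
  · have := main (w i) (by
      rw [mem_deficiencies, apply_apply_of_mul_self hw]
      exact (mem_deficiencies.1 hi).not_gt)
    rw [apply_apply_of_mul_self hw] at this
    rw [this, apply_apply_of_mul_self hw', ← this]
  · exact main i hi

lemma exists_deficiencies_eq (D : Finset (Fin n)) (hD : IsBallot D) :
    ∃ w : Equiv.Perm (Fin n), w * w = 1 ∧ deficiencies w = D := by
  induction D using Finset.induction_on_max with
  | empty => exact ⟨1, one_mul 1, by ext; simp [mem_deficiencies]⟩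
  | insert d D hd ih =>
    obtain ⟨w, hw, hwD⟩ := ih fun i =>
      (card_le_card fun j hj => by simp at hj ⊢; tauto).trans ((hD i).trans
        (card_le_card fun j hj => by simp at hj ⊢; tauto))
    have hww := apply_apply_of_mul_self hw
    have hdD : d ∉ D := fun h => (hd d h).false
    have hcard : #(D.image w) < #{j | j ≤ d ∧ j ∉ insert d D} := by
      have hle : #(insert d D) ≤ #{j | j ≤ d ∧ j ∈ insert d D} := by
        refine card_le_card fun j hj => ?_
        simp only [mem_filter, mem_univ, true_and]
        refine ⟨?_, hj⟩
        rcases mem_insert.1 hj with rfl | h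
        exacts [le_rfl, (hd j h).le]
      rw [card_insert_of_notMem hdD] at hle
      have := hD d
      have := card_image_le (s := D) (f := w)
      omega
    obtain ⟨u, hu, huD⟩ := exists_mem_notMem_of_card_lt_card hcard
    simp only [mem_filter, mem_univ, true_and, mem_insert, not_or] at hu
    obtain ⟨hud, hne, hu⟩ := hu
    have hlt : u < d := lt_of_le_of_ne hud hne
    have hfix : ∀ x, x ∉ D → (w x ∈ D → False) → w x = x := by
      intro x hx hwx
      rw [← hwD, mem_deficiencies] at hx hwx
      rw [hww] at hwx
      exact le_antisymm (not_lt.1 hwx) (not_lt.1 hx)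
    have hwu : w u = u := hfix u hu fun h => huD (mem_image.2 ⟨w u, h, hww u⟩)
    have hwd : w d = d := hfix d hdD fun h => by
      have h₁ := hd _ h
      rw [← mem_deficiencies, hwD] at h₁
      exact hdD h₁
    have hsw : ∀ x, x ≠ u → x ≠ d → Equiv.swap u d x = x := fun x =>
      Equiv.swap_apply_of_ne_of_ne
    refine ⟨w * Equiv.swap u d, ?_, ?_⟩
    · refine Equiv.ext fun x => ?_
      simp only [Equiv.Perm.mul_apply, Equiv.Perm.one_apply]
      by_cases hxu : x = u
      · simp [hxu, hwu, hwd]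
      by_cases hxd : x = d
      · simp [hxd, hwu, hwd]
      rw [hsw x hxu hxd, hsw, hww]
      · exact fun h => hxu (w.injective (h.trans hwu.symm))
      · exact fun h => hxd (w.injective (h.trans hwd.symm))
    · ext x
      rw [mem_insert, ← hwD, mem_deficiencies, mem_deficiencies, Equiv.Perm.mul_apply]
      by_cases hxu : x = u
      · simp [hxu, hwu, hwd, hlt.not_gt, hne]
      by_cases hxd : x = d
      · simp [hxd, hwu, hlt]
      simp [hsw x hxu hxd, hxd]

/-- Conjugating by `swap a c` when the arc at `a` covers `c` and `w c`
keeps the deficiencies and decreases `w` lexicographically. -/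
lemma exists_lex_lt {w : Equiv.Perm (Fin n)} (hw : w * w = 1) {a c : Fin n} (hac : a < c)
    (hc : c ≤ w c) (hca : w c < w a) :
    ∃ w' : Equiv.Perm (Fin n), w' * w' = 1 ∧ deficiencies w' = deficiencies w ∧
      toLex (⇑w') < toLex (⇑w) := by
  have hww := apply_apply_of_mul_self hw
  have hsw : ∀ x, x ≠ a → x ≠ c → Equiv.swap a c x = x := fun x =>
    Equiv.swap_apply_of_ne_of_ne
  have hwa : Equiv.swap a c (w a) = w a := hsw _ (hac.trans (hc.trans_lt hca)).ne'
    (hc.trans_lt hca).ne'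
  have hwc : a ≤ Equiv.swap a c (w c) ∧ Equiv.swap a c (w c) < w a := by
    by_cases h : w c = c
    · rw [h, Equiv.swap_apply_right]
      exact ⟨le_rfl, hac.trans (hc.trans_lt hca)⟩
    · rw [hsw _ (hac.trans_le hc).ne' h]
      exact ⟨(hac.trans_le hc).le, hca⟩
  refine ⟨Equiv.swap a c * w * Equiv.swap a c, ?_, ?_, ?_⟩
  · refine Equiv.ext fun x => ?_
    simp [Equiv.Perm.mul_apply, hww]
  · ext x
    rw [mem_deficiencies, mem_deficiencies, Equiv.Perm.mul_apply, Equiv.Perm.mul_apply]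
    by_cases hxa : x = a
    · subst hxa
      rw [Equiv.swap_apply_left]
      exact iff_of_false hwc.1.not_gt (hac.trans (hc.trans_lt hca)).not_gt
    by_cases hxc : x = c
    · subst hxc
      rw [Equiv.swap_apply_right, hwa]
      exact iff_of_false (hc.trans_lt hca).not_gt hc.not_gt
    rw [hsw x hxa hxc]
    by_cases h₁ : w x = a
    · have hx : x = w a := by rw [← h₁, hww]
      rw [h₁, Equiv.swap_apply_left, hx]
      exact iff_of_true (hc.trans_lt hca) (hac.trans (hc.trans_lt hca))
    by_cases h₂ : w x = c
    · have hx : x = w c := by rw [← h₂, hww]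
      have hlt : c < x := lt_of_le_of_ne (hx ▸ hc) (Ne.symm hxc)
      rw [h₂, Equiv.swap_apply_right]
      exact iff_of_true (hac.trans hlt) hlt
    rw [hsw _ h₁ h₂]
  · refine ⟨a, fun x hx => ?_, ?_⟩
    · simp only [Pi.toLex_apply, Equiv.Perm.mul_apply]
      rw [hsw x hx.ne (hx.trans hac).ne, hsw]
      · rintro rfl
        rw [hww] at hca
        exact lt_asymm hx (hac.trans (hc.trans_lt hca))
      · rintro rfl
        rw [hww] at hc
        exact hx.not_ge (hac.le.trans hc)
    · simpa [Equiv.Perm.mul_apply] using hwc.2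

lemma exists_avoids321_deficiencies_eq {D : Finset (Fin n)} (hD : IsBallot D) :
    ∃ w : Equiv.Perm (Fin n), w * w = 1 ∧ Avoids321 w ∧ deficiencies w = D := by
  obtain ⟨v, hv⟩ := exists_deficiencies_eq D hD
  obtain ⟨w, hw, hmin⟩ := exists_min_image
    ({w | w * w = 1 ∧ deficiencies w = D} : Finset (Equiv.Perm (Fin n)))
    (fun w => toLex (⇑w)) ⟨v, by simpa using hv⟩
  simp only [mem_filter, mem_univ, true_and] at hw hmin
  refine ⟨w, hw.1, (avoids321_iff_of_mul_self hw.1).2 fun a c hac hc => ?_, hw.2⟩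
  by_contra hlt
  obtain ⟨w', h₁, h₂, h₃⟩ := exists_lex_lt hw.1 hac hc
    (lt_of_le_of_ne (not_lt.1 hlt) (w.injective.ne hac.ne'))
  exact (hmin w' ⟨h₁, h₂.trans hw.2⟩).not_gt h₃

lemma card_involutions_eq_card_isBallot :
    Nat.card {w : Equiv.Perm (Fin n) // w * w = 1 ∧ FullyCommutative w} =
      Nat.card {D : Finset (Fin n) // IsBallot D} := by
  refine Nat.card_congr (Equiv.ofBijective
    (fun w => ⟨deficiencies w.1, isBallot_deficiencies w.2.1⟩) ⟨?_, ?_⟩)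
  · rintro ⟨w, hw, hf⟩ ⟨w', hw', hf'⟩ h
    exact Subtype.ext (eq_of_deficiencies_eq hw hw' hf.avoids321 hf'.avoids321
      (congrArg Subtype.val h))
  · rintro ⟨D, hD⟩
    obtain ⟨w, hw, ha, rfl⟩ := exists_avoids321_deficiencies_eq hD
    exact ⟨⟨w, hw, ha.fullyCommutative⟩, rfl⟩

end Involutions

section Walks

variable {n : ℕ}

/-- The step of a walk on `ℤ` encoded by a Boolean: down for `true`, up for `false`. -/
def walkStep (b : Bool) : ℤ := if b then -1 else 1

/-- The walk with steps `ε` started at height `h` never becomes negative. -/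
def StaysNonneg (h : ℤ) (ε : Fin n → Bool) : Prop :=
  0 ≤ h ∧ ∀ i, 0 ≤ h + ∑ j, if j ≤ i then walkStep (ε j) else 0

lemma staysNonneg_cons {h : ℤ} {b : Bool} {ε : Fin n → Bool} :
    StaysNonneg h (Fin.cons b ε : Fin (n + 1) → Bool) ↔
      0 ≤ h ∧ StaysNonneg (h + walkStep b) ε := by
  simp [StaysNonneg, Fin.forall_fin_succ, Fin.sum_univ_succ, add_assoc]

lemma sum_fin_succ_bool (F : (Fin (n + 1) → Bool) → ℕ) :
    ∑ ε, F ε =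
      ∑ ε : Fin n → Bool, F (Fin.cons true ε) + ∑ ε : Fin n → Bool, F (Fin.cons false ε) := by
  rw [← (Fin.consEquiv fun _ : Fin (n + 1) => Bool).sum_comp, Fintype.sum_prod_type,
    Fintype.sum_bool]
  rfl

open Classical in
/-- Reflection principle: walks staying nonnegative from height `h` are equinumerous with
walks whose total displacement lies in `[-h, h + 1]`. -/
lemma card_staysNonneg (n : ℕ) (h : ℤ) (hh : -1 ≤ h) :
    (∑ ε : Fin n → Bool, if StaysNonneg h ε then 1 else 0) =
      ∑ ε : Fin n → Bool,
        if -h ≤ ∑ j, walkStep (ε j) ∧ ∑ j, walkStep (ε j) ≤ h + 1 then 1 else 0 := by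
  induction n generalizing h with
  | zero =>
    simp only [StaysNonneg, IsEmpty.forall_iff, and_true, univ_eq_empty, sum_empty]
    refine sum_congr rfl fun _ _ => if_congr ?_ rfl rfl
    omega
  | succ n ih =>
    rw [sum_fin_succ_bool, sum_fin_succ_bool]
    simp only [staysNonneg_cons, Fin.sum_univ_succ, Fin.cons_zero, Fin.cons_succ]
    rcases hh.eq_or_lt with rfl | hpos
    · rw [sum_eq_zero, sum_eq_zero, sum_eq_zero, sum_eq_zero] <;>
        · intro _ _
          rw [if_neg]
          omega
    · have h0 : 0 ≤ h := by omega
      simp only [h0, true_and]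
      rw [ih _ (by simp [walkStep]; omega), ih _ (by simp [walkStep]; omega), ← sum_add_distrib,
        ← sum_add_distrib]
      refine sum_congr rfl fun ε _ => ?_
      simp only [walkStep, if_true, Bool.false_eq_true, if_false]
      generalize (∑ j, if ε j = true then (-1 : ℤ) else 1) = S
      split_ifs <;> omega

lemma sum_walkStep_mem (D : Finset (Fin n)) (p : Fin n → Prop) [DecidablePred p] :
    (∑ j, if p j then walkStep (decide (j ∈ D)) else 0) =
      (#{j | p j ∧ j ∉ D} : ℤ) - #{j | p j ∧ j ∈ D} := by
  rw [card_filter, card_filter]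
  push_cast
  rw [← sum_sub_distrib]
  refine sum_congr rfl fun j _ => ?_
  by_cases hp : p j <;> by_cases hj : j ∈ D <;> simp [hp, hj, walkStep]

lemma staysNonneg_iff_isBallot (D : Finset (Fin n)) :
    StaysNonneg 0 (fun j => decide (j ∈ D)) ↔ IsBallot D := by
  simp only [StaysNonneg, le_refl, true_and, zero_add, IsBallot]
  refine forall_congr' fun i => ?_
  rw [sum_walkStep_mem D (· ≤ i)]
  omega

lemma displacement_iff_card (D : Finset (Fin n)) :
    (-0 ≤ ∑ j, walkStep (decide (j ∈ D)) ∧ ∑ j, walkStep (decide (j ∈ D)) ≤ 0 + 1) ↔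
      #D = n / 2 := by
  have h := sum_walkStep_mem D fun _ => True
  simp only [if_true, true_and, filter_univ_mem] at h
  have hc : #{j | j ∉ D} = n - #D := by
    rw [← compl_filter, card_compl, filter_univ_mem, Fintype.card_fin]
  have hle : #D ≤ n := by simpa using card_le_univ D
  rw [h, hc]
  omega

/-- Subsets of `Fin n` as Boolean-valued functions. -/
def finsetEquivBool (n : ℕ) : Finset (Fin n) ≃ (Fin n → Bool) where
  toFun D j := decide (j ∈ D)
  invFun ε := {j | ε j = true}
  left_inv D := by ext; simp
  right_inv ε := by ext; simp

lemma card_isBallot (n : ℕ) :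
    Nat.card {D : Finset (Fin n) // IsBallot D} = n.choose (n / 2) := by
  classical
  have h := card_staysNonneg n 0 (by norm_num)
  rw [← (finsetEquivBool n).sum_comp, ← (finsetEquivBool n).sum_comp] at h
  simp only [finsetEquivBool, Equiv.coe_fn_mk, staysNonneg_iff_isBallot,
    displacement_iff_card] at h
  rw [← card_filter, ← card_filter] at h
  rw [Nat.card_eq_fintype_card, Fintype.card_subtype, h, ← Fintype.card_subtype,
    Fintype.card_finset_len, Fintype.card_fin]

end Walks

/-- The number of fully commutative involutions of `S_n` (elements `w` with `w² = e` that
are fully commutative) equals the binomial coefficient `C(n, ⌊n/2⌋)`. -/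
theorem card_fullyCommutative_involutions (n : ℕ) (hn : 1 ≤ n) :
    Nat.card {w : Equiv.Perm (Fin n) // w * w = 1 ∧ FullyCommutative w} =
      Nat.choose n (n / 2) := by
  rw [card_involutions_eq_card_isBallot, card_isBallot]
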